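/- No first-mover advantage for high defense cost: assume pa ≠ C_e − C0 for every e ∈ E; suppose T ∈ {C_e : e ∈ E} satisfies T − C0 > pa, ∑_{e: C_e > T} pd/(C_e−C0) < 1, ∑_{e: C_e > T} pd/(C_e−C0) + ∑_{e: C_e = T} pd/(T−C0) > 1, and additionally −T − pd·∑_{e: C_e > T}(C_e−T)/(C_e−C0) > −C0 − pd·∑_{e∈V}(C_e−pa−C0)/(C_e−C0). Then every Nash equilibrium of Γ and every SPE of Γ̃ give the defender the same utility −T − pd·∑_{e: C_e > T}(C_e−T)/(C_e−C0) and the attacker the same utility T − pa; in both games the total on-path attack probability is 1, and the SPE effort vector coincides with the NE security effort vector (ρ_e = (C_e−T)/(C_e−C0) for C_e > T and ρ_e = 0 otherwise). -/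

import Mathlib

open Finset

noncomputable section

namespace SecGame

variable {E : Type*} [Fintype E] [DecidableEq E]

/-- Usage cost after the attacker–defender interaction. -/
def usageCost (C0 : ℝ) (Ce : E → ℝ) (sd : Finset E) : Option E → ℝ
  | some e => if e ∈ sd then C0 else Ce e
  | none => C0

/-- Defender mixed strategy over subsets of facilities. -/
def IsDefMixed (σd : Finset E → ℝ) : Prop :=
  (∀ sd, 0 ≤ σd sd) ∧ ∑ sd : Finset E, σd sd = 1

/-- Attacker mixed strategy over `E ∪ {∅}`. -/
def IsAtkMixed (σa : Option E → ℝ) : Prop :=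
  (∀ sa, 0 ≤ σa sa) ∧ ∑ sa : Option E, σa sa = 1

/-- Defender expected utility. -/
def Ud (C0 : ℝ) (Ce : E → ℝ) (pd : ℝ) (σd : Finset E → ℝ) (σa : Option E → ℝ) : ℝ :=
  ∑ sd : Finset E, ∑ sa : Option E,
    σd sd * σa sa * (-(usageCost C0 Ce sd sa) - pd * (sd.card : ℝ))

/-- Attacker expected utility. -/
def Ua (C0 : ℝ) (Ce : E → ℝ) (pa : ℝ) (σd : Finset E → ℝ) (σa : Option E → ℝ) : ℝ :=
  ∑ sd : Finset E, ∑ sa : Option E,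
    σd sd * σa sa * (usageCost C0 Ce sd sa - pa * (if sa = none then 0 else 1))

/-- Security effort vector induced by a defender mixed strategy. -/
def effort (σd : Finset E → ℝ) (e : E) : ℝ :=
  ∑ sd ∈ Finset.univ.filter (fun sd => e ∈ sd), σd sd

/-- Nash equilibrium of the normal form game Γ. -/
def IsNE (C0 : ℝ) (Ce : E → ℝ) (pa pd : ℝ) (σd : Finset E → ℝ) (σa : Option E → ℝ) : Prop :=
  IsDefMixed σd ∧ IsAtkMixed σa ∧
  (∀ σd', IsDefMixed σd' → Ud C0 Ce pd σd' σa ≤ Ud C0 Ce pd σd σa) ∧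
  (∀ σa', IsAtkMixed σa' → Ua C0 Ce pa σd σa' ≤ Ua C0 Ce pa σd σa)

/-- Security effort vectors in the unit box `[0,1]^E`. -/
def InBox (ρ : E → ℝ) : Prop := ∀ e, 0 ≤ ρ e ∧ ρ e ≤ 1

/-- Defender expected utility as a function of the security effort vector. -/
def UdRho (C0 : ℝ) (Ce : E → ℝ) (pd : ℝ) (ρ : E → ℝ) (σa : Option E → ℝ) : ℝ :=
  -(∑ e : E, (ρ e * ((C0 - Ce e) * σa (some e) + pd) + Ce e * σa (some e))) - C0 * σa none

/-- Attacker expected utility as a function of the security effort vector. -/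
def UaRho (C0 : ℝ) (Ce : E → ℝ) (pa : ℝ) (ρ : E → ℝ) (σa : Option E → ℝ) : ℝ :=
  (∑ e : E, (ρ e * (C0 - Ce e) * σa (some e) + Ce e * σa (some e))) + C0 * σa none
    - pa * ∑ e : E, σa (some e)

/-- Threshold security effort for a vulnerable facility. -/
def rhoHat (C0 : ℝ) (Ce : E → ℝ) (pa : ℝ) (e : E) : ℝ := (Ce e - pa - C0) / (Ce e - C0)

/-- Subgame perfect equilibrium of the sequential game Γ̃. -/
def IsSPE (C0 : ℝ) (Ce : E → ℝ) (pa pd : ℝ) (ρstar : E → ℝ)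
    (σastar : (E → ℝ) → Option E → ℝ) : Prop :=
  InBox ρstar ∧
  (∀ ρ, InBox ρ → IsAtkMixed (σastar ρ) ∧
    ∀ σa, IsAtkMixed σa → UaRho C0 Ce pa ρ σa ≤ UaRho C0 Ce pa ρ (σastar ρ)) ∧
  (∀ ρ, InBox ρ → UdRho C0 Ce pd ρ (σastar ρ) ≤ UdRho C0 Ce pd ρstar (σastar ρstar))

/-- The extreme points of the simplex detect optimality of a mixed strategy `σ` for a linear
payoff `w`: no pure payoff exceeds the value, and `σ` only charges optimal pure strategies. -/
lemma mixed_best_response {ι : Type*} [Fintype ι] [DecidableEq ι] (w σ : ι → ℝ)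
    (h0 : ∀ i, 0 ≤ σ i) (h1 : ∑ i, σ i = 1)
    (hbr : ∀ τ : ι → ℝ, (∀ i, 0 ≤ τ i) → ∑ i, τ i = 1 → ∑ i, τ i * w i ≤ ∑ i, σ i * w i) (i : ι) :
    w i ≤ ∑ j, σ j * w j ∧ (0 < σ i → w i = ∑ j, σ j * w j) := by
  set m := ∑ j, σ j * w j with hm
  have hle : ∀ j, w j ≤ m := fun j => by
    have h := hbr (Pi.single j 1)
      (fun k => by by_cases hk : k = j <;> simp [hk]) (by simp)
    simpa [Pi.single_apply] using h
  refine ⟨hle i, fun hi => ?_⟩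
  have hzero : ∑ j, σ j * (m - w j) = 0 := by
    simp only [mul_sub, sum_sub_distrib, ← sum_mul, h1, ← hm]
    ring
  have hall := (sum_eq_zero_iff_of_nonneg
    (fun j _ => mul_nonneg (h0 j) (sub_nonneg.2 (hle j)))).1 hzero i (mem_univ i)
  rcases mul_eq_zero.1 hall with h | h <;> linarith

/-- Attacker payoff of each pure strategy against the effort vector `ρ`. -/
def atkPayoff (C0 : ℝ) (Ce : E → ℝ) (pa : ℝ) (ρ : E → ℝ) : Option E → ℝ
  | some e => Ce e - ρ e * (Ce e - C0) - pa
  | none => C0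

lemma uaRho_eq_sum (C0 : ℝ) (Ce : E → ℝ) (pa : ℝ) (ρ : E → ℝ) (σa : Option E → ℝ) :
    UaRho C0 Ce pa ρ σa = ∑ a, σa a * atkPayoff C0 Ce pa ρ a := by
  simp only [UaRho, Fintype.sum_option, atkPayoff, mul_sum]
  rw [add_comm, mul_comm C0, add_sub_assoc, ← sum_sub_distrib]
  congr 1
  exact sum_congr rfl fun e _ => by ring

lemma udRho_eq_uaRho (C0 : ℝ) (Ce : E → ℝ) (pa pd : ℝ) (ρ : E → ℝ) (σa : Option E → ℝ) :
    UdRho C0 Ce pd ρ σa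
      = -UaRho C0 Ce pa ρ σa - pa * ∑ e, σa (some e) - pd * ∑ e, ρ e := by
  have h : ∑ e, (ρ e * ((C0 - Ce e) * σa (some e) + pd) + Ce e * σa (some e))
      = ∑ e, (ρ e * (C0 - Ce e) * σa (some e) + Ce e * σa (some e)) + pd * ∑ e, ρ e := by
    rw [mul_sum, ← sum_add_distrib]
    exact sum_congr rfl fun e _ => by ring
  rw [UdRho, UaRho, h]
  ring

lemma sum_mul_sum_mem (σd : Finset E → ℝ) (g : E → ℝ) :
    ∑ sd, σd sd * ∑ e ∈ sd, g e = ∑ e, effort σd e * g e := by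
  have h : ∀ sd : Finset E, σd sd * ∑ e ∈ sd, g e = ∑ e, if e ∈ sd then σd sd * g e else 0 :=
    fun sd => by rw [mul_sum, ← sum_filter]; simp
  simp only [h, effort, sum_mul]
  rw [sum_comm]
  exact sum_congr rfl fun e _ => by rw [← sum_filter]

lemma effort_nonneg {σd : Finset E → ℝ} (h : IsDefMixed σd) (e : E) : 0 ≤ effort σd e :=
  sum_nonneg fun sd _ => h.1 sd

lemma effort_le_one {σd : Finset E → ℝ} (h : IsDefMixed σd) (e : E) : effort σd e ≤ 1 := by
  rw [← h.2]
  exact sum_le_sum_of_subset_of_nonneg (filter_subset _ _) fun sd _ _ => h.1 sd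

lemma sum_usageCost (C0 : ℝ) (Ce : E → ℝ) (sd : Finset E) (σa : Option E → ℝ) :
    ∑ a, σa a * usageCost C0 Ce sd a
      = σa none * C0 + ∑ e, σa (some e) * Ce e - ∑ e ∈ sd, (Ce e - C0) * σa (some e) := by
  have h : ∑ e ∈ sd, (Ce e - C0) * σa (some e)
      = ∑ e, if e ∈ sd then (Ce e - C0) * σa (some e) else 0 := by
    rw [← sum_filter]; simp
  rw [Fintype.sum_option, h, add_sub_assoc, ← sum_sub_distrib]
  simp only [usageCost]
  congr 1
  refine sum_congr rfl fun e _ => ?_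
  split_ifs <;> ring

lemma ua_eq_uaRho (C0 : ℝ) (Ce : E → ℝ) (pa : ℝ) {σd : Finset E → ℝ} (hd : IsDefMixed σd)
    (σa : Option E → ℝ) : Ua C0 Ce pa σd σa = UaRho C0 Ce pa (effort σd) σa := by
  have h : ∀ sd : Finset E, ∑ a, σd sd * σa a *
      (usageCost C0 Ce sd a - pa * (if a = none then 0 else 1))
      = σd sd * (σa none * C0 + ∑ e, σa (some e) * Ce e - pa * ∑ e, σa (some e))
        - σd sd * ∑ e ∈ sd, (Ce e - C0) * σa (some e) := fun sd => by
    have h1 : ∑ a, σa a * (pa * (if a = none then 0 else 1)) = pa * ∑ e, σa (some e) := by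
      rw [Fintype.sum_option, mul_sum]
      simp [mul_comm]
    calc _ = σd sd * (∑ a, σa a * usageCost C0 Ce sd a
            - ∑ a, σa a * (pa * (if a = none then 0 else 1))) := by
          rw [← sum_sub_distrib, mul_sum]
          exact sum_congr rfl fun a _ => by ring
      _ = _ := by rw [h1, sum_usageCost]; ring
  simp only [Ua, h]
  rw [sum_sub_distrib, ← sum_mul, hd.2, sum_mul_sum_mem, UaRho, sum_add_distrib]
  have h2 : ∑ e, effort σd e * (C0 - Ce e) * σa (some e)
      = -∑ e, effort σd e * ((Ce e - C0) * σa (some e)) := by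
    rw [← sum_neg_distrib]
    exact sum_congr rfl fun e _ => by ring
  simp only [h2, mul_comm (Ce _)]
  ring

lemma ud_eq_udRho (C0 : ℝ) (Ce : E → ℝ) (pd : ℝ) {σd : Finset E → ℝ} (hd : IsDefMixed σd)
    {σa : Option E → ℝ} (ha : IsAtkMixed σa) :
    Ud C0 Ce pd σd σa = UdRho C0 Ce pd (effort σd) σa := by
  have h : ∀ sd : Finset E, ∑ a, σd sd * σa a * (-(usageCost C0 Ce sd a) - pd * (sd.card : ℝ))
      = σd sd * ∑ e ∈ sd, ((Ce e - C0) * σa (some e) - pd)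
        - σd sd * (σa none * C0 + ∑ e, σa (some e) * Ce e) := fun sd => by
    calc _ = σd sd * (-(∑ a, σa a * usageCost C0 Ce sd a) - (∑ a, σa a) * (pd * sd.card)) := by
          rw [sum_mul, ← sum_neg_distrib, ← sum_sub_distrib, mul_sum]
          exact sum_congr rfl fun a _ => by ring
      _ = _ := by
          rw [ha.2, sum_usageCost, sum_sub_distrib, sum_const, nsmul_eq_mul]
          ring
  simp only [Ud, h]
  rw [sum_sub_distrib, ← sum_mul, hd.2, sum_mul_sum_mem, UdRho, sum_add_distrib]
  have h2 : ∑ e, effort σd e * ((C0 - Ce e) * σa (some e) + pd)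
      = -∑ e, effort σd e * ((Ce e - C0) * σa (some e) - pd) := by
    rw [← sum_neg_distrib]
    exact sum_congr rfl fun e _ => by ring
  simp only [h2, mul_comm (Ce _)]
  ring

lemma isDefMixed_single (sd : Finset E) : IsDefMixed (Pi.single sd (1 : ℝ)) :=
  ⟨fun sd' => by by_cases h : sd' = sd <;> simp [h], by simp⟩

lemma effort_single (sd : Finset E) (e : E) :
    effort (Pi.single sd (1 : ℝ)) e = if e ∈ sd then 1 else 0 := by
  simp [effort, Pi.single_apply]

/-- In a Nash equilibrium each facility is secured fully, or not at all, according to the sign of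
the marginal gain from securing it. -/
lemma effort_of_isNE {C0 pa pd : ℝ} {Ce : E → ℝ} {σd : Finset E → ℝ} {σa : Option E → ℝ}
    (h : IsNE C0 Ce pa pd σd σa) (e : E) :
    (0 < (Ce e - C0) * σa (some e) - pd → effort σd e = 1) ∧
      ((Ce e - C0) * σa (some e) - pd < 0 → effort σd e = 0) := by
  obtain ⟨hd, ha, hdbr, -⟩ := h
  set g : E → ℝ := fun e => (Ce e - C0) * σa (some e) - pd with hg
  have hform : ∀ ρ : E → ℝ, UdRho C0 Ce pd ρ σa
      = ∑ e, ρ e * g e - (∑ e, Ce e * σa (some e) + C0 * σa none) := fun ρ => by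
    have : ∑ e, ρ e * ((C0 - Ce e) * σa (some e) + pd) = -∑ e, ρ e * g e := by
      rw [← sum_neg_distrib]
      exact sum_congr rfl fun e _ => by simp only [hg]; ring
    rw [UdRho, sum_add_distrib, this]
    ring
  have hbest := hdbr _ (isDefMixed_single (univ.filter fun e => 0 < g e))
  rw [ud_eq_udRho _ _ _ (isDefMixed_single _) ha, ud_eq_udRho _ _ _ hd ha, hform, hform] at hbest
  simp only [effort_single, mem_filter, mem_univ, true_and] at hbest
  have hterm : ∀ e, effort σd e * g e ≤ (if 0 < g e then 1 else 0) * g e := fun e => by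
    have h0 := effort_nonneg hd e
    have h1 := effort_le_one hd e
    split_ifs with hpos
    · nlinarith
    · nlinarith
  have heq : effort σd e * g e = (if 0 < g e then 1 else 0) * g e :=
    (sum_eq_sum_iff_of_le fun e _ => hterm e).1
      (le_antisymm (sum_le_sum fun e _ => hterm e) (by linarith)) e (mem_univ e)
  change (0 < g e → _) ∧ (g e < 0 → _)
  constructor
  · intro hpos
    rw [if_pos hpos] at heq
    exact mul_right_cancel₀ hpos.ne' heq
  · intro hneg
    rw [if_neg hneg.le.not_gt, zero_mul] at heq
    exact (mul_eq_zero.1 heq).resolve_right hneg.ne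

lemma atkPayoff_best_response {C0 pa : ℝ} {Ce ρ : E → ℝ} {σa : Option E → ℝ}
    (ha : IsAtkMixed σa)
    (hbr : ∀ τ, IsAtkMixed τ → UaRho C0 Ce pa ρ τ ≤ UaRho C0 Ce pa ρ σa) (a : Option E) :
    atkPayoff C0 Ce pa ρ a ≤ UaRho C0 Ce pa ρ σa ∧
      (0 < σa a → atkPayoff C0 Ce pa ρ a = UaRho C0 Ce pa ρ σa) := by
  simp only [uaRho_eq_sum] at hbr ⊢
  exact mixed_best_response _ _ ha.1 ha.2 (fun τ h0 h1 => hbr τ ⟨h0, h1⟩) a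

/-- If staying idle is strictly suboptimal, a best-responding attacker attacks for sure. -/
lemma sum_attack_eq_one {C0 pa : ℝ} {Ce ρ : E → ℝ} {σa : Option E → ℝ} (ha : IsAtkMixed σa)
    (hbr : ∀ τ, IsAtkMixed τ → UaRho C0 Ce pa ρ τ ≤ UaRho C0 Ce pa ρ σa)
    (hgt : C0 < UaRho C0 Ce pa ρ σa) : ∑ e, σa (some e) = 1 := by
  have hnone : σa none = 0 := by
    by_contra hne
    have h := (atkPayoff_best_response ha hbr none).2 (lt_of_le_of_ne (ha.1 none) (Ne.symm hne))
    simp only [atkPayoff] at h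
    linarith
  have h := ha.2
  rwa [Fintype.sum_option, hnone, zero_add] at h

/-- An attack on a facility whose usage cost does not exceed a level `T ≥ C0` pays at most
`T - pa`. -/
lemma atkPayoff_some_le {C0 pa T : ℝ} {Ce ρ : E → ℝ} (hbox : InBox ρ) {e : E}
    (hT : C0 ≤ T) (he : Ce e ≤ T) : atkPayoff C0 Ce pa ρ (some e) ≤ T - pa := by
  have h0 := (hbox e).1
  have h1 := (hbox e).2
  simp only [atkPayoff]
  nlinarith

/-- The effort that equalizes the attacker's payoff over the facilities costlier than `T` and
leaves the others unsecured. -/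
def levelEffort (C0 : ℝ) (Ce : E → ℝ) (T : ℝ) (e : E) : ℝ :=
  if T < Ce e then (Ce e - T) / (Ce e - C0) else 0

lemma sum_levelEffort (C0 : ℝ) (Ce : E → ℝ) (T : ℝ) :
    ∑ e, levelEffort C0 Ce T e
      = ∑ e ∈ univ.filter (fun e => T < Ce e), (Ce e - T) / (Ce e - C0) := by
  rw [sum_filter]; rfl

lemma levelEffort_mem_box {C0 T : ℝ} (Ce : E → ℝ) (hT : C0 < T) :
    InBox (levelEffort C0 Ce T) := fun e => by
  unfold levelEffort
  split_ifs with h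
  · have hpos : 0 < Ce e - C0 := by linarith
    exact ⟨div_nonneg (by linarith) hpos.le, (div_le_one hpos).2 (by linarith)⟩
  · simp

lemma le_effort_of_atkPayoff_le {C0 pa t : ℝ} {Ce ρ : E → ℝ} {e : E} (hC : C0 < Ce e)
    (h : atkPayoff C0 Ce pa ρ (some e) ≤ t - pa) : (Ce e - t) / (Ce e - C0) ≤ ρ e := by
  simp only [atkPayoff] at h
  rw [div_le_iff₀ (by linarith)]
  linarith

/-- Nash equilibrium effort and attacker utility in the regime where the marginal budget
`∑ pd / (C_e - C0)` crosses `1` at the cost level `T`. -/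
lemma isNE_effort_and_utility {C0 pa pd T : ℝ} {Ce : E → ℝ} (hpa : 0 < pa) (hpd : 0 < pd)
    (hvul : pa < T - C0)
    (hlt : ∑ e ∈ univ.filter (fun e => T < Ce e), pd / (Ce e - C0) < 1)
    (hgt : 1 < ∑ e ∈ univ.filter (fun e => T ≤ Ce e), pd / (Ce e - C0))
    {σd : Finset E → ℝ} {σa : Option E → ℝ} (h : IsNE C0 Ce pa pd σd σa) :
    effort σd = levelEffort C0 Ce T ∧ UaRho C0 Ce pa (effort σd) σa = T - pa ∧
      ∑ e, σa (some e) = 1 := by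
  have hdef := effort_of_isNE h
  obtain ⟨hd, ha, -, habr⟩ := h
  have hbox : InBox (effort σd) := fun e => ⟨effort_nonneg hd e, effort_le_one hd e⟩
  simp only [ua_eq_uaRho _ _ _ hd] at habr
  set ρ := effort σd with hρ
  have hbest := atkPayoff_best_response ha habr
  have hle : ∀ e, Ce e - ρ e * (Ce e - C0) - pa ≤ UaRho C0 Ce pa ρ σa := fun e => (hbest (some e)).1
  have hsupp : ∀ e, 0 < σa (some e) → Ce e - ρ e * (Ce e - C0) - pa = UaRho C0 Ce pa ρ σa :=
    fun e => (hbest (some e)).2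
  have hidle : C0 ≤ UaRho C0 Ce pa ρ σa := (hbest none).1
  set m := UaRho C0 Ce pa ρ σa with hm
  have hσ : ∀ e, 0 ≤ σa (some e) := fun e => ha.1 _
  have htotal : ∑ e, σa (some e) ≤ 1 := by
    have h1 := ha.2
    rw [Fintype.sum_option] at h1
    linarith [ha.1 none]
  have hupper : ∀ e, C0 < Ce e → σa (some e) ≤ pd / (Ce e - C0) := fun e he => by
    by_contra! hlt'
    have hpos : 0 < Ce e - C0 := by linarith
    rw [div_lt_iff₀ hpos] at hlt'
    have h1 := (hdef e).1 (by linarith)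
    have h2 := hsupp e (by nlinarith)
    rw [h1] at h2
    linarith
  have hlower : ∀ e, C0 < Ce e → 0 < ρ e → pd / (Ce e - C0) ≤ σa (some e) := fun e he hpos => by
    by_contra! hlt'
    rw [lt_div_iff₀ (by linarith)] at hlt'
    have h1 := (hdef e).2 (by linarith)
    linarith
  have hunattacked : ∀ e, σa (some e) = 0 → ρ e = 0 := fun e he =>
    (hdef e).2 (by rw [he]; linarith)
  have hmT : T - pa ≤ m := by
    by_contra! hlt'
    have hsum : ∑ e ∈ univ.filter (fun e => T ≤ Ce e), pd / (Ce e - C0)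
        ≤ ∑ e ∈ univ.filter (fun e => T ≤ Ce e), σa (some e) := by
      refine sum_le_sum fun e he => ?_
      have he' : T ≤ Ce e := (mem_filter.1 he).2
      refine hlower e (by linarith) ?_
      have h1 := hle e
      by_contra! hneg
      have : ρ e * (Ce e - C0) ≤ 0 := mul_nonpos_of_nonpos_of_nonneg hneg (by linarith)
      linarith
    have hsub : ∑ e ∈ univ.filter (fun e => T ≤ Ce e), σa (some e) ≤ ∑ e, σa (some e) :=
      sum_le_sum_of_subset_of_nonneg (filter_subset _ _) fun e _ _ => hσ e
    linarith
  have hone : ∑ e, σa (some e) = 1 := sum_attack_eq_one ha habr (by linarith)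
  have hTm : m ≤ T - pa := by
    by_contra! hlt'
    have hzero : ∀ e, ¬ T < Ce e → σa (some e) = 0 := fun e he => by
      by_contra hne
      have h1 := hsupp e (lt_of_le_of_ne (hσ e) (Ne.symm hne))
      have h2 := atkPayoff_some_le (pa := pa) hbox (by linarith : C0 ≤ T) (not_lt.1 he)
      simp only [atkPayoff] at h2
      linarith
    have h1 : ∑ e ∈ univ.filter (fun e => T < Ce e), σa (some e) = ∑ e, σa (some e) :=
      sum_subset (filter_subset _ _) fun e _ he => hzero e (by simpa using he)
    have h2 : ∑ e ∈ univ.filter (fun e => T < Ce e), σa (some e)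
        ≤ ∑ e ∈ univ.filter (fun e => T < Ce e), pd / (Ce e - C0) :=
      sum_le_sum fun e he => hupper e (by linarith [(mem_filter.1 he).2])
    linarith
  have hmeq : m = T - pa := le_antisymm hTm hmT
  refine ⟨funext fun e => ?_, hmeq, hone⟩
  unfold levelEffort
  split_ifs with he
  · have hpos : 0 < Ce e - C0 := by linarith
    have hρpos : 0 < ρ e := by
      have h1 := hle e
      by_contra! hneg
      have : ρ e * (Ce e - C0) ≤ 0 := mul_nonpos_of_nonpos_of_nonneg hneg hpos.le
      linarith
    have h2 := hsupp e (lt_of_lt_of_le (div_pos hpd hpos) (hlower e (by linarith) hρpos))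
    rw [eq_div_iff hpos.ne']
    linarith
  · by_contra hne
    have hρpos : 0 < ρ e := lt_of_le_of_ne (hbox e).1 (Ne.symm hne)
    have hσpos : 0 < σa (some e) :=
      lt_of_le_of_ne (hσ e) fun h0 => hne (hunattacked e h0.symm)
    have h1 := hsupp e hσpos
    have h2 := not_lt.1 he
    rcases le_or_gt (Ce e) C0 with h3 | h3
    · have h4 := atkPayoff_some_le (pa := pa) hbox le_rfl h3
      simp only [atkPayoff] at h4
      linarith
    · have : 0 < ρ e * (Ce e - C0) := mul_pos hρpos (by linarith)
      linarith

/-- Against `levelEffort`, every best response of the attacker attacks for sure and earns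
`T - pa`. -/
lemma udRho_levelEffort {C0 pa pd T : ℝ} {Ce : E → ℝ} (hpa : 0 < pa) (hT : ∃ e, Ce e = T)
    (hvul : pa < T - C0) {σa : Option E → ℝ} (ha : IsAtkMixed σa)
    (hbr : ∀ τ, IsAtkMixed τ → UaRho C0 Ce pa (levelEffort C0 Ce T) τ
      ≤ UaRho C0 Ce pa (levelEffort C0 Ce T) σa) :
    UdRho C0 Ce pd (levelEffort C0 Ce T) σa = -T - pd * ∑ e, levelEffort C0 Ce T e := by
  have hbest := atkPayoff_best_response ha hbr
  have hbox := levelEffort_mem_box Ce (by linarith : C0 < T)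
  have hle : ∀ a, atkPayoff C0 Ce pa (levelEffort C0 Ce T) a ≤ T - pa := by
    rintro (_ | e)
    · simp only [atkPayoff]; linarith
    · rcases lt_or_ge T (Ce e) with he | he
      · have hpos : Ce e - C0 ≠ 0 := by linarith
        simp only [atkPayoff, levelEffort, if_pos he, div_mul_cancel₀ _ hpos]
        linarith
      · exact atkPayoff_some_le hbox (by linarith) he
  have hm : UaRho C0 Ce pa (levelEffort C0 Ce T) σa = T - pa := by
    apply le_antisymm
    · rw [uaRho_eq_sum]
      calc _ ≤ ∑ a, σa a * (T - pa) :=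
            sum_le_sum fun a _ => mul_le_mul_of_nonneg_left (hle a) (ha.1 a)
        _ = T - pa := by rw [← sum_mul, ha.2, one_mul]
    · obtain ⟨e, he⟩ := hT
      have h := (hbest (some e)).1
      simpa [atkPayoff, levelEffort, he] using h
  rw [udRho_eq_uaRho C0 Ce pa, sum_attack_eq_one ha hbr (by linarith), hm]
  ring

/-- A defender commitment that does at least as well as `levelEffort` is `levelEffort`. -/
lemma eq_levelEffort_of_le_udRho {C0 pa pd T : ℝ} {Ce : E → ℝ} (hpa : 0 < pa) (hpd : 0 < pd)
    (hvul : pa < T - C0)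
    (hlt : ∑ e ∈ univ.filter (fun e => T < Ce e), pd / (Ce e - C0) < 1)
    (hgt : 1 < ∑ e ∈ univ.filter (fun e => T ≤ Ce e), pd / (Ce e - C0))
    (hhigh : -T - pd * ∑ e, levelEffort C0 Ce T e
      > -C0 - pd * ∑ e ∈ univ.filter (fun e => C0 < Ce e - pa), (Ce e - pa - C0) / (Ce e - C0))
    {ρ : E → ℝ} (hbox : InBox ρ) {σa : Option E → ℝ} (ha : IsAtkMixed σa)
    (hbr : ∀ τ, IsAtkMixed τ → UaRho C0 Ce pa ρ τ ≤ UaRho C0 Ce pa ρ σa)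
    (hud : -T - pd * ∑ e, levelEffort C0 Ce T e ≤ UdRho C0 Ce pd ρ σa) :
    ρ = levelEffort C0 Ce T ∧ UaRho C0 Ce pa ρ σa = T - pa ∧ ∑ e, σa (some e) = 1 := by
  have hbest := atkPayoff_best_response ha hbr
  rw [udRho_eq_uaRho C0 Ce pa] at hud
  obtain ⟨t, ht⟩ : ∃ t, UaRho C0 Ce pa ρ σa = t - pa := ⟨_, (add_sub_cancel_right _ pa).symm⟩
  have hidle : C0 ≤ t - pa := ht ▸ (hbest none).1
  have hρ : ∀ e, C0 < Ce e → (Ce e - t) / (Ce e - C0) ≤ ρ e := fun e he =>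
    le_effort_of_atkPayoff_le he (ht ▸ (hbest (some e)).1)
  have hbound : ∀ s : Finset E, (∀ e ∈ s, C0 < Ce e) →
      ∑ e ∈ s, (Ce e - t) / (Ce e - C0) ≤ ∑ e, ρ e := fun s hs =>
    (sum_le_sum fun e he => hρ e (hs e he)).trans
      (sum_le_sum_of_subset_of_nonneg (subset_univ s) fun e _ _ => (hbox e).1)
  have hattack : 0 ≤ ∑ e, σa (some e) := sum_nonneg fun e _ => ha.1 _
  rw [ht] at hud
  rcases hidle.eq_or_lt with heq | hgt'
  · exfalso
    have h1 := hbound (univ.filter fun e => C0 < Ce e - pa)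
      fun e he => by linarith [(mem_filter.1 he).2]
    have h2 : ∑ e ∈ univ.filter (fun e => C0 < Ce e - pa), (Ce e - t) / (Ce e - C0)
        = ∑ e ∈ univ.filter (fun e => C0 < Ce e - pa), (Ce e - pa - C0) / (Ce e - C0) :=
      sum_congr rfl fun e _ => by rw [show t = C0 + pa by linarith]; ring
    rw [h2] at h1
    nlinarith [mul_le_mul_of_nonneg_left h1 hpd.le, mul_nonneg hpa.le hattack]
  have hone := sum_attack_eq_one ha hbr (ht ▸ hgt')
  rw [hone] at hud
  have hbudget : ∀ s : Finset E, (∀ e ∈ s, C0 < Ce e) →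
      ∑ e ∈ s, (Ce e - T) / (Ce e - C0) = ∑ e, levelEffort C0 Ce T e →
      0 ≤ (T - t) * (1 - ∑ e ∈ s, pd / (Ce e - C0)) := fun s hs hsum => by
    have h1 := hbound s hs
    have h2 : pd * ∑ e ∈ s, (Ce e - t) / (Ce e - C0)
        = pd * ∑ e ∈ s, (Ce e - T) / (Ce e - C0) + (T - t) * ∑ e ∈ s, pd / (Ce e - C0) := by
      simp only [mul_sum, ← sum_add_distrib]
      exact sum_congr rfl fun e _ => by ring
    rw [hsum] at h2
    nlinarith [mul_le_mul_of_nonneg_left h1 hpd.le]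
  have htT : t = T := by
    apply le_antisymm
    · have h := hbudget (univ.filter fun e => T < Ce e)
        (fun e he => by linarith [(mem_filter.1 he).2]) (sum_levelEffort C0 Ce T).symm
      by_contra! hlt'
      nlinarith
    · have h := hbudget (univ.filter fun e => T ≤ Ce e)
        (fun e he => by linarith [(mem_filter.1 he).2]) (by
          rw [sum_filter]
          refine sum_congr rfl fun e _ => ?_
          unfold levelEffort
          rcases lt_trichotomy T (Ce e) with he | he | he
          · rw [if_pos he, if_pos he.le]
          · simp [he]
          · rw [if_neg he.not_ge, if_neg he.not_gt])
      by_contra! hlt'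
      nlinarith
  subst htT
  have hge : ∀ e, levelEffort C0 Ce t e ≤ ρ e := fun e => by
    unfold levelEffort
    split_ifs with he
    · exact hρ e (by linarith)
    · exact (hbox e).1
  have hsum : ∑ e, ρ e ≤ ∑ e, levelEffort C0 Ce t e :=
    le_of_mul_le_mul_left (by linarith) hpd
  have heq := (sum_eq_sum_iff_of_le fun e _ => hge e).1
    (le_antisymm (sum_le_sum fun e _ => hge e) hsum)
  exact ⟨funext fun e => (heq e (mem_univ e)).symm, ht, hone⟩

/-- **No first-mover advantage for relatively high defense cost (set H).**
Assume `pa ≠ C_e − C0` for every `e`, the type II regime conditions for some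
`T ∈ {C_e}`, and additionally
`−T − pd·∑_{C_e>T}(C_e−T)/(C_e−C0) > −C0 − pd·∑_{e∈V}(C_e−pa−C0)/(C_e−C0)`.
Then every NE of Γ and every SPE of Γ̃ give the defender the same utility
`−T − pd·∑_{C_e>T}(C_e−T)/(C_e−C0)` and the attacker the same utility `T − pa`; in both
games the total on-path attack probability is `1`, and the SPE effort vector coincides
with the NE security effort vector: `(C_e−T)/(C_e−C0)` when `C_e > T` and `0` otherwise. -/
theorem no_first_mover_advantage_high_cost {E : Type*} [Fintype E] [DecidableEq E] [Nonempty E]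
    (C0 : ℝ) (Ce : E → ℝ) (pa pd : ℝ) (hpa : 0 < pa) (hpd : 0 < pd)
    (hgen : ∀ e : E, pa ≠ Ce e - C0)
    (T : ℝ) (hT : ∃ e : E, Ce e = T)
    (hvul : pa < T - C0)
    (hlt : ∑ e ∈ Finset.univ.filter (fun e => T < Ce e), pd / (Ce e - C0) < 1)
    (hgt : 1 < (∑ e ∈ Finset.univ.filter (fun e => T < Ce e), pd / (Ce e - C0))
      + ∑ e ∈ Finset.univ.filter (fun e => Ce e = T), pd / (T - C0))
    (hhigh : -T - pd * ∑ e ∈ Finset.univ.filter (fun e => T < Ce e), (Ce e - T) / (Ce e - C0)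
      > -C0 - pd * ∑ e ∈ Finset.univ.filter (fun e => C0 < Ce e - pa),
          (Ce e - pa - C0) / (Ce e - C0)) :
    ∀ (σd : Finset E → ℝ) (σa : Option E → ℝ), IsNE C0 Ce pa pd σd σa →
      ∀ (ρstar : E → ℝ) (σastar : (E → ℝ) → Option E → ℝ),
        IsSPE C0 Ce pa pd ρstar σastar →
          Ud C0 Ce pd σd σa
            = -T - pd * ∑ e ∈ Finset.univ.filter (fun e => T < Ce e),
                (Ce e - T) / (Ce e - C0) ∧
          UdRho C0 Ce pd ρstar (σastar ρstar)
            = -T - pd * ∑ e ∈ Finset.univ.filter (fun e => T < Ce e),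
                (Ce e - T) / (Ce e - C0) ∧
          Ua C0 Ce pa σd σa = T - pa ∧
          UaRho C0 Ce pa ρstar (σastar ρstar) = T - pa ∧
          (∑ e : E, σa (some e)) = 1 ∧
          (∑ e : E, σastar ρstar (some e)) = 1 ∧
          (∀ e : E, T < Ce e →
            ρstar e = (Ce e - T) / (Ce e - C0) ∧ effort σd e = (Ce e - T) / (Ce e - C0)) ∧
          (∀ e : E, ¬ T < Ce e → ρstar e = 0 ∧ effort σd e = 0) := by
  intro σd σa hNE ρstar σastar ⟨hbox, hbr, hopt⟩
  have hgt' : 1 < ∑ e ∈ univ.filter (fun e => T ≤ Ce e), pd / (Ce e - C0) := by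
    refine hgt.trans_eq ?_
    simp only [sum_filter, ← sum_add_distrib]
    refine sum_congr rfl fun e _ => ?_
    rcases lt_trichotomy T (Ce e) with he | he | he
    · simp [he, he.le, he.ne']
    · simp [he]
    · simp [he.not_gt, he.not_ge, he.ne]
  rw [← sum_levelEffort] at hhigh ⊢
  obtain ⟨hρ, hua, hσ⟩ := isNE_effort_and_utility hpa hpd hvul hlt hgt' hNE
  have hlevel := levelEffort_mem_box Ce (by linarith : C0 < T)
  have hdev := hopt _ hlevel
  rw [udRho_levelEffort hpa hT hvul (hbr _ hlevel).1 (hbr _ hlevel).2] at hdev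
  obtain ⟨hρs, huas, hσs⟩ := eq_levelEffort_of_le_udRho hpa hpd hvul hlt hgt' hhigh hbox
    (hbr _ hbox).1 (hbr _ hbox).2 hdev
  refine ⟨?_, ?_, ?_, huas, hσ, hσs, fun e he => ?_, fun e he => ?_⟩
  · rw [ud_eq_udRho _ _ _ hNE.1 hNE.2.1, udRho_eq_uaRho C0 Ce pa, hua, hσ, hρ]
    ring
  · rw [udRho_eq_uaRho C0 Ce pa, huas, hσs, ← hρs]
    ring
  · rw [ua_eq_uaRho _ _ _ hNE.1, hua]
  · rw [hρ, hρs, levelEffort, if_pos he]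
    exact ⟨rfl, rfl⟩
  · rw [hρ, hρs, levelEffort, if_neg he]
    exact ⟨rfl, rfl⟩


end SecGame
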